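/- arXiv:1604.02712 — 8 statements merged into one kernel-verified Lean document; each statement's English description precedes it below -/
import Mathlib

section
/- For every positive integer n, the number of n²×n² S-permutation matrices equals (n!)^(2n). -/
/-- An n²×n² binary matrix (entries in `Fin 2`), indexed by row indices `(i,j)` and
column indices `(k,l)`, is an S-permutation matrix if every row, every column, and
every block `(i,k)` contains exactly one entry equal to 1. -/
def IsSPermMatrix (n : ℕ) (A : Fin n × Fin n → Fin n × Fin n → Fin 2) : Prop :=
  (∀ r : Fin n × Fin n, ∃! c : Fin n × Fin n, A r c = 1) ∧
  (∀ c : Fin n × Fin n, ∃! r : Fin n × Fin n, A r c = 1) ∧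
  (∀ i k : Fin n, ∃! p : Fin n × Fin n, A (i, p.1) (k, p.2) = 1)

/-- The matrix whose only 1 in block `(i, k)` is in row `σ i k` and column `τ k i` of the block. -/
def sPermMatrixOfPerms {n : ℕ} (σ τ : Fin n → Equiv.Perm (Fin n)) :
    Fin n × Fin n → Fin n × Fin n → Fin 2 :=
  fun r c => if σ r.1 c.1 = r.2 ∧ τ c.1 r.1 = c.2 then 1 else 0

theorem sPermMatrixOfPerms_eq_one_iff {n : ℕ} (σ τ : Fin n → Equiv.Perm (Fin n))
    (r c : Fin n × Fin n) :
    sPermMatrixOfPerms σ τ r c = 1 ↔ σ r.1 c.1 = r.2 ∧ τ c.1 r.1 = c.2 := by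
  simp [sPermMatrixOfPerms]

theorem isSPermMatrix_sPermMatrixOfPerms {n : ℕ} (σ τ : Fin n → Equiv.Perm (Fin n)) :
    IsSPermMatrix n (sPermMatrixOfPerms σ τ) := by
  simp only [IsSPermMatrix, sPermMatrixOfPerms_eq_one_iff]
  refine ⟨fun ⟨i, j⟩ => ⟨((σ i).symm j, τ ((σ i).symm j) i), by simp, ?_⟩,
    fun ⟨k, l⟩ => ⟨((τ k).symm l, σ ((τ k).symm l) k), by simp, ?_⟩,
    fun i k => ⟨(σ i k, τ k i), by simp, ?_⟩⟩
  · rintro ⟨k, l⟩ ⟨hj, hl⟩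
    dsimp only at hj hl
    simp [← hj, hl]
  · rintro ⟨i, j⟩ ⟨hj, hl⟩
    dsimp only at hj hl
    simp [← hl, hj]
  · rintro ⟨j, l⟩ ⟨rfl, rfl⟩
    rfl

theorem sPermMatrixOfPerms_injective {n : ℕ} {σ τ σ' τ' : Fin n → Equiv.Perm (Fin n)}
    (h : sPermMatrixOfPerms σ τ = sPermMatrixOfPerms σ' τ') : σ = σ' ∧ τ = τ' := by
  have key (i k : Fin n) : σ' i k = σ i k ∧ τ' k i = τ k i := by
    rw [← sPermMatrixOfPerms_eq_one_iff σ' τ' (i, σ i k) (k, τ k i), ← h,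
      sPermMatrixOfPerms_eq_one_iff]
    exact ⟨rfl, rfl⟩
  exact ⟨funext fun i => Equiv.ext fun k => (key i k).1.symm,
    funext fun k => Equiv.ext fun i => (key i k).2.symm⟩

theorem IsSPermMatrix.exists_perms {n : ℕ} {A : Fin n × Fin n → Fin n × Fin n → Fin 2}
    (hA : IsSPermMatrix n A) :
    ∃ σ τ : Fin n → Equiv.Perm (Fin n), sPermMatrixOfPerms σ τ = A := by
  obtain ⟨hrow, hcol, hblock⟩ := hA
  choose p hp hp_unique using hblock
  beta_reduce at hp
  have hσ (i : Fin n) : Function.Injective fun k => (p i k).1 := fun k k' h => by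
    have h' := hp i k'
    rw [← show (p i k).1 = (p i k').1 from h] at h'
    exact congrArg Prod.fst ((hrow (i, (p i k).1)).unique (hp i k) h')
  have hτ (k : Fin n) : Function.Injective fun i => (p i k).2 := fun i i' h => by
    have h' := hp i' k
    rw [← show (p i k).2 = (p i' k).2 from h] at h'
    exact congrArg Prod.fst ((hcol (k, (p i k).2)).unique (hp i k) h')
  refine ⟨fun i => Equiv.ofBijective _ (Finite.injective_iff_bijective.mp (hσ i)),
    fun k => Equiv.ofBijective _ (Finite.injective_iff_bijective.mp (hτ k)), ?_⟩
  funext ⟨i, j⟩ ⟨k, l⟩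
  have hiff : ((p i k).1 = j ∧ (p i k).2 = l) ↔ A (i, j) (k, l) = 1 := by
    constructor
    · rintro ⟨rfl, rfl⟩
      exact hp i k
    · intro h
      simp [← hp_unique i k (j, l) h]
  simp only [sPermMatrixOfPerms, Equiv.ofBijective_apply, hiff]
  split_ifs with h
  · exact h.symm
  · omega

theorem number_of_S_permutation_matrices (n : ℕ) (hn : 0 < n) :
    Nat.card {A : Fin n × Fin n → Fin n × Fin n → Fin 2 // IsSPermMatrix n A} =
      (Nat.factorial n) ^ (2 * n) := by
  let f : (Fin n → Equiv.Perm (Fin n)) × (Fin n → Equiv.Perm (Fin n)) →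
      {A : Fin n × Fin n → Fin n × Fin n → Fin 2 // IsSPermMatrix n A} :=
    fun q => ⟨sPermMatrixOfPerms q.1 q.2, isSPermMatrix_sPermMatrixOfPerms q.1 q.2⟩
  have hf : Function.Bijective f := by
    refine ⟨fun q q' h => ?_, fun ⟨A, hA⟩ => ?_⟩
    · obtain ⟨h₁, h₂⟩ := sPermMatrixOfPerms_injective (congrArg Subtype.val h)
      exact Prod.ext h₁ h₂
    · obtain ⟨σ, τ, h⟩ := hA.exists_perms
      exact ⟨(σ, τ), Subtype.ext h⟩
  rw [← Nat.card_eq_of_bijective f hf, Nat.card_eq_fintype_card]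
  simp [Fintype.card_perm, two_mul, pow_add]
end

section
/- For every integer n ≥ 2, the number of unordered pairs of disjoint matrices in Σ_{n²} equals the number of unordered pairs of disjoint matrices in Π_n. -/
def IsPiMatrix (n : ℕ) (π : Fin n → Fin n → Fin n × Fin n) : Prop :=
  (∀ i : Fin n, Function.Bijective fun j => (π i j).1) ∧
  (∀ j : Fin n, Function.Bijective fun i => (π i j).2)

/-- Two binary matrices are disjoint if there is no position at which both have a 1. -/
def DisjointBin (n : ℕ) (A B : Fin n × Fin n → Fin n × Fin n → Fin 2) : Prop :=
  ∀ r c : Fin n × Fin n, ¬(A r c = 1 ∧ B r c = 1)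

/-- Two `Π_n`-matrices are disjoint if they differ at every position. -/
def DisjointPi (n : ℕ) (π π' : Fin n → Fin n → Fin n × Fin n) : Prop :=
  ∀ i j : Fin n, π i j ≠ π' i j

/-- The binary matrix whose block `(i, k)` has its only 1 at the position `π i k`. -/
def blockMatrix (n : ℕ) (π : Fin n → Fin n → Fin n × Fin n) :
    Fin n × Fin n → Fin n × Fin n → Fin 2 :=
  fun r c => if π r.1 c.1 = (r.2, c.2) then 1 else 0

theorem blockMatrix_eq_one_iff {n : ℕ} {π : Fin n → Fin n → Fin n × Fin n}
    {r c : Fin n × Fin n} : blockMatrix n π r c = 1 ↔ π r.1 c.1 = (r.2, c.2) := by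
  simp [blockMatrix]

theorem IsPiMatrix.isSPermMatrix_blockMatrix {n : ℕ} {π : Fin n → Fin n → Fin n × Fin n}
    (h : IsPiMatrix n π) : IsSPermMatrix n (blockMatrix n π) := by
  simp only [IsSPermMatrix, blockMatrix_eq_one_iff]
  refine ⟨fun ⟨i, a⟩ => ?_, fun ⟨k, b⟩ => ?_, fun i k => ⟨π i k, rfl, fun p hp => hp.symm⟩⟩
  · obtain ⟨k, rfl⟩ := (h.1 i).2 a
    refine ⟨(k, (π i k).2), rfl, fun ⟨k', b⟩ hc => ?_⟩
    change π i k' = ((π i k).1, b) at hc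
    obtain rfl : k' = k := (h.1 i).1 (congrArg Prod.fst hc :)
    exact congrArg (Prod.mk k') (congrArg Prod.snd hc).symm
  · obtain ⟨i, rfl⟩ := (h.2 k).2 b
    refine ⟨(i, (π i k).1), rfl, fun ⟨i', a⟩ hr => ?_⟩
    change π i' k = (a, (π i k).2) at hr
    obtain rfl : i' = i := (h.2 k).1 (congrArg Prod.snd hr :)
    exact congrArg (Prod.mk i') (congrArg Prod.fst hr).symm

theorem blockMatrix_injective (n : ℕ) : Function.Injective (blockMatrix n) := by
  intro π π' h
  funext i k
  have h1 : blockMatrix n π (i, (π i k).1) (k, (π i k).2) = 1 := blockMatrix_eq_one_iff.2 rfl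
  rw [h] at h1
  exact (blockMatrix_eq_one_iff.1 h1).symm

theorem IsSPermMatrix.exists_blockMatrix_eq {n : ℕ} {A : Fin n × Fin n → Fin n × Fin n → Fin 2}
    (h : IsSPermMatrix n A) : ∃ π, IsPiMatrix n π ∧ blockMatrix n π = A := by
  obtain ⟨hrow, hcol, hblock⟩ := h
  choose π hπ huniq using hblock
  refine ⟨π, ⟨fun i => Finite.injective_iff_bijective.1 fun k k' hk => ?_,
    fun k => Finite.injective_iff_bijective.1 fun i i' hi => ?_⟩, ?_⟩
  · have h' : A (i, (π i k').1) (k', (π i k').2) = 1 := hπ i k'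
    rw [← show (π i k).1 = (π i k').1 from hk] at h'
    exact congrArg Prod.fst ((hrow _).unique (hπ i k) h')
  · have h' : A (i', (π i' k).1) (k, (π i' k).2) = 1 := hπ i' k
    rw [← show (π i k).2 = (π i' k).2 from hi] at h'
    exact congrArg Prod.fst ((hcol _).unique (hπ i k) h')
  · funext r c
    have key : blockMatrix n π r c = 1 ↔ A r c = 1 := by
      rw [blockMatrix_eq_one_iff]
      refine ⟨fun hp => ?_, fun hA => (huniq r.1 c.1 (r.2, c.2) hA).symm⟩
      have h1 := hπ r.1 c.1
      rwa [hp] at h1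
    omega

theorem disjointBin_blockMatrix_iff {n : ℕ} {π π' : Fin n → Fin n → Fin n × Fin n} :
    DisjointBin n (blockMatrix n π) (blockMatrix n π') ↔ DisjointPi n π π' := by
  simp only [DisjointBin, DisjointPi, blockMatrix_eq_one_iff]
  exact ⟨fun h i k hik => h (i, (π i k).1) (k, (π i k).2) ⟨rfl, hik.symm⟩,
    fun h r c hrc => h r.1 c.1 (hrc.1.trans hrc.2.symm)⟩

/-- `Π_n`-matrices correspond to S-permutation matrices. -/
noncomputable def piMatrixEquiv (n : ℕ) :
    {π : Fin n → Fin n → Fin n × Fin n // IsPiMatrix n π} ≃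
      {A : Fin n × Fin n → Fin n × Fin n → Fin 2 // IsSPermMatrix n A} :=
  Equiv.ofBijective (fun π => ⟨blockMatrix n π.1, π.2.isSPermMatrix_blockMatrix⟩)
    ⟨fun _ _ h => Subtype.ext (blockMatrix_injective n (congrArg Subtype.val h)), fun A => by
      obtain ⟨π, hπ, hA⟩ := A.2.exists_blockMatrix_eq
      exact ⟨⟨π, hπ⟩, Subtype.ext hA⟩⟩

theorem disjointBin_piMatrixEquiv_iff {n : ℕ}
    (π π' : {π : Fin n → Fin n → Fin n × Fin n // IsPiMatrix n π}) :
    DisjointBin n (piMatrixEquiv n π).1 (piMatrixEquiv n π').1 ↔ DisjointPi n π.1 π'.1 :=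
  disjointBin_blockMatrix_iff

theorem Sym2.map_bijective {α β : Type*} {f : α → β} (hf : Function.Bijective f) :
    Function.Bijective (Sym2.map f) := by
  refine ⟨Sym2.map.injective hf.1, fun s => ?_⟩
  induction s with | _ b b'
  obtain ⟨a, rfl⟩ := hf.2 b
  obtain ⟨a', rfl⟩ := hf.2 b'
  exact ⟨s(a, a'), rfl⟩

/-- The number of unordered pairs of disjoint matrices in `Σ_{n²}` equals the number of
unordered pairs of disjoint matrices in `Π_n`. -/
theorem disjoint_pairs_sperm_eq_disjoint_pairs_pi (n : ℕ) (hn : 2 ≤ n) :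
    Nat.card {s : Sym2 {A : Fin n × Fin n → Fin n × Fin n → Fin 2 // IsSPermMatrix n A} //
        ∃ A B, s = s(A, B) ∧ DisjointBin n A.1 B.1} =
    Nat.card {s : Sym2 {π : Fin n → Fin n → Fin n × Fin n // IsPiMatrix n π} //
        ∃ π π', s = s(π, π') ∧ DisjointPi n π.1 π'.1} := by
  refine (Nat.card_congr ((Equiv.ofBijective _
    (Sym2.map_bijective (piMatrixEquiv n).bijective)).subtypeEquiv fun s => ?_)).symm
  constructor
  · rintro ⟨π, π', rfl, h⟩
    exact ⟨_, _, rfl, (disjointBin_piMatrixEquiv_iff π π').2 h⟩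
  · rintro ⟨A, B, hs, h⟩
    obtain ⟨π, rfl⟩ := (piMatrixEquiv n).surjective A
    obtain ⟨π', rfl⟩ := (piMatrixEquiv n).surjective B
    exact ⟨π, π', Sym2.map.injective (piMatrixEquiv n).injective hs,
      (disjointBin_piMatrixEquiv_iff π π').1 h⟩
end

section
/- Let n be a positive integer, let π ∈ Π_n, and let A be an n×n binary matrix. Then the number of matrices π' ∈ Π_n satisfying π' i j = π i j for every position (i,j) with A i j = 1 equals ∏_{k=0}^{n} [(n−k)!]^{ψ_k(A)}, where ψ_k(A) = r_k(A) + c_k(A). -/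
/-- `rowCount n A k` is the number of rows of the binary matrix `A` containing exactly `k` ones. -/
def rowCount (n : ℕ) (A : Fin n → Fin n → Fin 2) (k : ℕ) : ℕ :=
  (Finset.univ.filter fun i : Fin n =>
    (Finset.univ.filter fun j : Fin n => A i j = 1).card = k).card

/-- `colCount n A k` is the number of columns of the binary matrix `A` containing exactly `k` ones. -/
def colCount (n : ℕ) (A : Fin n → Fin n → Fin 2) (k : ℕ) : ℕ :=
  (Finset.univ.filter fun j : Fin n =>
    (Finset.univ.filter fun i : Fin n => A i j = 1).card = k).card

/-- `ψ_k(A) = r_k(A) + c_k(A)`. -/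
def psi (n : ℕ) (A : Fin n → Fin n → Fin 2) (k : ℕ) : ℕ :=
  rowCount n A k + colCount n A k

/-- The permutations agreeing with a bijection `g` on `p` correspond to the permutations
of the complement of `p`. -/
theorem card_bijective_agreeing {α : Type*} [Fintype α] [DecidableEq α] (g : α → α)
    (hg : Function.Bijective g) (p : α → Prop) [DecidablePred p] :
    Nat.card {f : α → α // Function.Bijective f ∧ ∀ a, p a → f a = g a} =
      (Fintype.card α - (Finset.univ.filter p).card).factorial := by
  let G : Equiv.Perm α := Equiv.ofBijective g hg
  let e : {σ : Equiv.Perm α // ∀ a, ¬¬p a → σ a = a} ≃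
      {f : α → α // Function.Bijective f ∧ ∀ a, p a → f a = g a} :=
    { toFun := fun σ => ⟨G ∘ σ.1, G.bijective.comp σ.1.bijective, fun a ha =>
        congrArg g (σ.2 a (not_not.mpr ha))⟩
      invFun := fun f => ⟨(Equiv.ofBijective f.1 f.2.1).trans G.symm, fun a ha => by
        exact G.symm_apply_eq.mpr (f.2.2 a (not_not.mp ha))⟩
      left_inv := fun σ => by ext; simp
      right_inv := fun f => by ext; simp }
  rw [← Nat.card_congr ((Equiv.Perm.subtypeEquivSubtypePerm fun a => ¬p a).trans e),
    Nat.card_eq_fintype_card, Fintype.card_perm, Fintype.card_subtype_compl,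
    Fintype.card_subtype]

/-- Grouping the factors of a product according to the value of a bounded statistic. -/
theorem prod_apply_eq_prod_pow_card {ι M : Type*} [Fintype ι] [CommMonoid M] (n : ℕ)
    (c : ι → ℕ) (hc : ∀ i, c i ≤ n) (F : ℕ → M) :
    ∏ i, F (c i) =
      ∏ k ∈ Finset.range (n + 1), F k ^ (Finset.univ.filter fun i => c i = k).card := by
  rw [← Finset.prod_fiberwise_of_maps_to
    (fun i _ => Finset.mem_range.mpr (Nat.lt_succ_of_le (hc i)))]
  refine Finset.prod_congr rfl fun k _ => ?_
  rw [← Finset.prod_const]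
  exact Finset.prod_congr rfl fun i hi => by rw [(Finset.mem_filter.mp hi).2]

/-- A matrix in `Π_n` agreeing with `π` on the ones of `A` consists of independent choices of
its first coordinates row by row and its second coordinates column by column. -/
def agreeingPiMatricesEquiv (n : ℕ) (π : Fin n → Fin n → Fin n × Fin n)
    (A : Fin n → Fin n → Fin 2) :
    {π' : Fin n → Fin n → Fin n × Fin n //
        IsPiMatrix n π' ∧ ∀ i j : Fin n, A i j = 1 → π' i j = π i j} ≃
      (∀ i, {f : Fin n → Fin n // Function.Bijective f ∧ ∀ j, A i j = 1 → f j = (π i j).1}) ×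
      (∀ j, {f : Fin n → Fin n // Function.Bijective f ∧ ∀ i, A i j = 1 → f i = (π i j).2}) where
  toFun π' :=
    (fun i => ⟨fun j => (π'.1 i j).1, π'.2.1.1 i, fun j h => congrArg Prod.fst (π'.2.2 i j h)⟩,
      fun j => ⟨fun i => (π'.1 i j).2, π'.2.1.2 j, fun i h => congrArg Prod.snd (π'.2.2 i j h)⟩)
  invFun f := ⟨fun i j => ((f.1 i).1 j, (f.2 j).1 i),
    ⟨fun i => (f.1 i).2.1, fun j => (f.2 j).2.1⟩,
    fun i j h => Prod.ext ((f.1 i).2.2 j h) ((f.2 j).2.2 i h)⟩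
  left_inv _ := rfl
  right_inv _ := rfl

/-- The number of `π' ∈ Π_n` agreeing with `π` at every position where the binary matrix `A`
has a 1 equals `∏_{k=0}^{n} [(n−k)!]^{ψ_k(A)}`. -/
theorem count_agreeing_pi_matrices (n : ℕ) (hn : 0 < n)
    (π : Fin n → Fin n → Fin n × Fin n) (hπ : IsPiMatrix n π)
    (A : Fin n → Fin n → Fin 2) :
    Nat.card {π' : Fin n → Fin n → Fin n × Fin n //
        IsPiMatrix n π' ∧ ∀ i j : Fin n, A i j = 1 → π' i j = π i j} =
      ∏ k ∈ Finset.range (n + 1), (Nat.factorial (n - k)) ^ (psi n A k) := by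
  rw [Nat.card_congr (agreeingPiMatricesEquiv n π A), Nat.card_prod, Nat.card_pi, Nat.card_pi]
  simp only [card_bijective_agreeing _ (hπ.1 _), card_bijective_agreeing _ (hπ.2 _),
    Fintype.card_fin, psi, pow_add, Finset.prod_mul_distrib]
  have card_le (p : Fin n → Prop) [DecidablePred p] : (Finset.univ.filter p).card ≤ n :=
    (Finset.card_le_univ _).trans_eq (Fintype.card_fin n)
  rw [prod_apply_eq_prod_pow_card n (fun i => (Finset.univ.filter fun j => A i j = 1).card)
      (fun i => card_le _) fun k => (n - k).factorial,
    prod_apply_eq_prod_pow_card n (fun j => (Finset.univ.filter fun i => A i j = 1).card)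
      (fun j => card_le _) fun k => (n - k).factorial]
  rfl
end

section
/- Let n be a positive integer, let π ∈ Π_n, and let 0 ≤ k ≤ n². Then the number q(n,k) of pairs (A, π') where A is an n×n binary matrix with exactly k ones and π' ∈ Π_n agrees with π at every position where A has a 1, satisfies q(n,k) = Σ_{A ∈ B_{n,k}} ∏_{i=0}^{n} [(n−i)!]^{ψ_i(A)}; in particular q(n,k) does not depend on the choice of π. -/
/-- `ε(A)`: the total number of ones in the binary matrix `A`. -/
def eps (n : ℕ) (A : Fin n → Fin n → Fin 2) : ℕ :=
  (Finset.univ.filter fun p : Fin n × Fin n => A p.1 p.2 = 1).card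

/-- The self-bijections of a finite type that agree with a given one on `s` correspond to the
permutations of the complement of `s`. -/
theorem card_bijective_agreeing_on {α : Type*} [Fintype α] [DecidableEq α] (e : α → α)
    (he : Function.Bijective e) (s : Finset α) :
    Nat.card {f : α → α // Function.Bijective f ∧ ∀ a ∈ s, f a = e a} =
      (Fintype.card α - s.card).factorial := by
  let ε : Equiv.Perm α := Equiv.ofBijective e he
  have hε (a : α) : ε a = e a := rfl
  let F : {f : α → α // Function.Bijective f ∧ ∀ a ∈ s, f a = e a} ≃
      {σ : Equiv.Perm α // ∀ a, ¬ a ∉ s → σ a = a} :=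
    { toFun := fun f => ⟨(Equiv.ofBijective f.1 f.2.1).trans ε.symm, fun a ha => by
        simp [f.2.2 a (not_not.mp ha), ← hε]⟩
      invFun := fun σ => ⟨σ.1.trans ε, (σ.1.trans ε).bijective, fun a ha => by
        simp [σ.2 a (not_not.mpr ha), hε]⟩
      left_inv := fun f => by ext a; simp
      right_inv := fun σ => by ext a; simp }
  rw [Nat.card_congr (F.trans (Equiv.Perm.subtypeEquivSubtypePerm (· ∉ s)).symm), Nat.card_perm,
    Nat.card_eq_fintype_card, Fintype.card_subtype_compl]
  simp

/-- The product of `g (f i)` over `i`, grouped according to the value of `f i`. -/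
theorem prod_comp_eq_prod_range_pow {ι M : Type*} [Fintype ι] [CommMonoid M] (n : ℕ) (f : ι → ℕ)
    (hf : ∀ i, f i ≤ n) (g : ℕ → M) :
    ∏ i, g (f i) =
      ∏ m ∈ Finset.range (n + 1), g m ^ (Finset.univ.filter fun i => f i = m).card := by
  rw [← Finset.prod_fiberwise_of_maps_to (t := Finset.range (n + 1)) (g := f)
    fun i _ => Finset.mem_range_succ_iff.mpr (hf i)]
  refine Finset.prod_congr rfl fun m _ => ?_
  rw [Finset.prod_congr rfl fun i hi => by rw [(Finset.mem_filter.mp hi).2], Finset.prod_const]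

/-- A matrix in `Π_n` agreeing with `π` on the ones of `A` is a choice of a bijection for every
row and, independently, for every column. -/
def agreeingEquiv (n : ℕ) (π : Fin n → Fin n → Fin n × Fin n) (A : Fin n → Fin n → Fin 2) :
    {π' : Fin n → Fin n → Fin n × Fin n //
        IsPiMatrix n π' ∧ ∀ i j : Fin n, A i j = 1 → π' i j = π i j} ≃
      (∀ i : Fin n, {f : Fin n → Fin n // Function.Bijective f ∧
        ∀ j ∈ Finset.univ.filter fun j : Fin n => A i j = 1, f j = (π i j).1}) ×
      (∀ j : Fin n, {f : Fin n → Fin n // Function.Bijective f ∧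
        ∀ i ∈ Finset.univ.filter fun i : Fin n => A i j = 1, f i = (π i j).2}) where
  toFun π' :=
    (fun i => ⟨fun j => (π'.1 i j).1, π'.2.1.1 i, fun j hj =>
      congrArg (·.1) (π'.2.2 i j (Finset.mem_filter.mp hj).2)⟩,
    fun j => ⟨fun i => (π'.1 i j).2, π'.2.1.2 j, fun i hi =>
      congrArg (·.2) (π'.2.2 i j (Finset.mem_filter.mp hi).2)⟩)
  invFun p := ⟨fun i j => ((p.1 i).1 j, (p.2 j).1 i),
    ⟨fun i => (p.1 i).2.1, fun j => (p.2 j).2.1⟩, fun i j h =>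
      Prod.ext ((p.1 i).2.2 j (Finset.mem_filter.mpr ⟨Finset.mem_univ _, h⟩))
        ((p.2 j).2.2 i (Finset.mem_filter.mpr ⟨Finset.mem_univ _, h⟩))⟩
  left_inv _ := rfl
  right_inv _ := rfl

theorem card_agreeing (n : ℕ) (π : Fin n → Fin n → Fin n × Fin n) (hπ : IsPiMatrix n π)
    (A : Fin n → Fin n → Fin 2) :
    Nat.card {π' : Fin n → Fin n → Fin n × Fin n //
        IsPiMatrix n π' ∧ ∀ i j : Fin n, A i j = 1 → π' i j = π i j} =
      ∏ i ∈ Finset.range (n + 1), (Nat.factorial (n - i)) ^ (psi n A i) := by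
  have hle (s : Finset (Fin n)) : s.card ≤ n := by simpa using s.card_le_univ
  rw [Nat.card_congr (agreeingEquiv n π A), Nat.card_prod, Nat.card_pi, Nat.card_pi]
  simp_rw [fun i => card_bijective_agreeing_on _ (hπ.1 i),
    fun j => card_bijective_agreeing_on _ (hπ.2 j), Fintype.card_fin]
  rw [prod_comp_eq_prod_range_pow n _ (fun _ => hle _) fun m => (n - m).factorial,
    prod_comp_eq_prod_range_pow n _ (fun _ => hle _) fun m => (n - m).factorial,
    ← Finset.prod_mul_distrib]
  exact Finset.prod_congr rfl fun m _ => (pow_add _ _ _).symm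


/-- The number of pairs `(A, π')`, where `A` is an `n×n` binary matrix with exactly `k` ones
and `π' ∈ Π_n` agrees with `π` at every position where `A` has a 1, equals
`Σ_{A ∈ B_{n,k}} ∏_{i=0}^{n} [(n−i)!]^{ψ_i(A)}`; in particular it does not depend on `π`. -/
theorem count_pairs_with_agreement (n k : ℕ) (hn : 0 < n) (hk : k ≤ n ^ 2)
    (π : Fin n → Fin n → Fin n × Fin n) (hπ : IsPiMatrix n π) :
    Nat.card {p : (Fin n → Fin n → Fin 2) × (Fin n → Fin n → Fin n × Fin n) //
        eps n p.1 = k ∧ IsPiMatrix n p.2 ∧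
          ∀ i j : Fin n, p.1 i j = 1 → p.2 i j = π i j} =
      ∑ A ∈ Finset.univ.filter (fun A : Fin n → Fin n → Fin 2 => eps n A = k),
        ∏ i ∈ Finset.range (n + 1), (Nat.factorial (n - i)) ^ (psi n A i) := by
  let F : {p : (Fin n → Fin n → Fin 2) × (Fin n → Fin n → Fin n × Fin n) //
        eps n p.1 = k ∧ IsPiMatrix n p.2 ∧ ∀ i j : Fin n, p.1 i j = 1 → p.2 i j = π i j} ≃
      Σ A : {A : Fin n → Fin n → Fin 2 // eps n A = k},
        {π' : Fin n → Fin n → Fin n × Fin n //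
          IsPiMatrix n π' ∧ ∀ i j : Fin n, A.1 i j = 1 → π' i j = π i j} :=
    { toFun := fun p => ⟨⟨p.1.1, p.2.1⟩, ⟨p.1.2, p.2.2⟩⟩
      invFun := fun q => ⟨(q.1.1, q.2.1), q.1.2, q.2.2⟩
      left_inv := fun _ => rfl
      right_inv := fun _ => rfl }
  rw [Nat.card_congr F, Nat.card_sigma]
  simp_rw [fun A => card_agreeing n π hπ A]
  exact (Finset.sum_subtype _ (fun _ => Finset.mem_filter_univ _)
    fun A => ∏ i ∈ Finset.range (n + 1), (Nat.factorial (n - i)) ^ (psi n A i)).symm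
end

section
/- Let n be a positive integer. An n²×n² matrix M with entries in {1, 2, …, n²} is a Sudoku matrix if and only if there exist pairwise disjoint S-permutation matrices A_1, A_2, …, A_{n²} ∈ Σ_{n²} such that M = 1·A_1 + 2·A_2 + ⋯ + n²·A_{n²}. -/
/-- An `n²×n²` matrix with natural-number entries is a Sudoku matrix if every row, every
column, and every block contains each value of `{1,…,n²}` exactly once. -/
def IsSudoku (n : ℕ) (M : Fin n × Fin n → Fin n × Fin n → ℕ) : Prop :=
  (∀ r : Fin n × Fin n, ∀ m ∈ Finset.Icc 1 (n ^ 2), ∃! c : Fin n × Fin n, M r c = m) ∧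
  (∀ c : Fin n × Fin n, ∀ m ∈ Finset.Icc 1 (n ^ 2), ∃! r : Fin n × Fin n, M r c = m) ∧
  (∀ i k : Fin n, ∀ m ∈ Finset.Icc 1 (n ^ 2), ∃! p : Fin n × Fin n, M (i, p.1) (k, p.2) = m)

/-- A matrix is a Sudoku matrix iff the indicator matrices of its level sets are all
S-permutation matrices. -/
theorem isSudoku_iff_forall_isSPermMatrix (n : ℕ) (M : Fin n × Fin n → Fin n × Fin n → ℕ)
    (A : Fin (n ^ 2) → Fin n × Fin n → Fin n × Fin n → Fin 2)
    (hA : ∀ k r c, A k r c = 1 ↔ M r c = (k : ℕ) + 1) :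
    IsSudoku n M ↔ ∀ k, IsSPermMatrix n (A k) := by
  unfold IsSudoku IsSPermMatrix
  simp only [hA]
  constructor
  · rintro ⟨hrow, hcol, hblock⟩ k
    have hk : (k : ℕ) + 1 ∈ Finset.Icc 1 (n ^ 2) := by
      have := k.isLt
      simp only [Finset.mem_Icc]
      omega
    exact ⟨fun r => hrow r _ hk, fun c => hcol c _ hk, fun i j => hblock i j _ hk⟩
  · intro h
    have hlevel : ∀ m ∈ Finset.Icc 1 (n ^ 2), ∃ k : Fin (n ^ 2), (k : ℕ) + 1 = m := by
      intro m hm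
      rw [Finset.mem_Icc] at hm
      exact ⟨⟨m - 1, by omega⟩, by simp only; omega⟩
    refine ⟨fun r m hm => ?_, fun c m hm => ?_, fun i j m hm => ?_⟩ <;>
      obtain ⟨k, rfl⟩ := hlevel m hm
    · exact (h k).1 r
    · exact (h k).2.1 c
    · exact (h k).2.2 i j

/-- A weighted sum of binary numbers in which only the `k`-th one is nonzero. -/
theorem sum_succ_mul_eq_of_unique {N : ℕ} (a : Fin N → Fin 2) (k : Fin N) (hk : a k = 1)
    (h : ∀ k', k' ≠ k → a k' ≠ 1) :
    ∑ j : Fin N, ((j : ℕ) + 1) * (a j : ℕ) = (k : ℕ) + 1 := by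
  rw [Finset.sum_eq_single k]
  · simp [hk]
  · intro j _ hj
    have : a j = 0 := by have := h j hj; lia
    simp [this]
  · simp

/-- An `n²×n²` matrix `M` with entries in `{1,…,n²}` is a Sudoku matrix if and only if
there exist pairwise disjoint S-permutation matrices `A_1, …, A_{n²}` with
`M = 1·A_1 + 2·A_2 + ⋯ + n²·A_{n²}`. -/
theorem sudoku_iff_disjoint_sperm_decomposition (n : ℕ) (hn : 0 < n)
    (M : Fin n × Fin n → Fin n × Fin n → ℕ)
    (hM : ∀ r c : Fin n × Fin n, M r c ∈ Finset.Icc 1 (n ^ 2)) :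
    IsSudoku n M ↔
      ∃ A : Fin (n ^ 2) → (Fin n × Fin n → Fin n × Fin n → Fin 2),
        (∀ k, IsSPermMatrix n (A k)) ∧
        (∀ k k', k ≠ k' → DisjointBin n (A k) (A k')) ∧
        (∀ r c : Fin n × Fin n, M r c = ∑ k : Fin (n ^ 2), ((k : ℕ) + 1) * ((A k r c : Fin 2) : ℕ)) := by
  constructor
  · intro h
    have hA : ∀ (k : Fin (n ^ 2)) (r c : Fin n × Fin n),
        (if M r c = (k : ℕ) + 1 then 1 else 0 : Fin 2) = 1 ↔ M r c = (k : ℕ) + 1 := by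
      intro k r c
      split_ifs with hk <;> simp [hk]
    refine ⟨fun k r c => if M r c = (k : ℕ) + 1 then 1 else 0,
      (isSudoku_iff_forall_isSPermMatrix n M _ hA).1 h, ?_, ?_⟩
    · rintro k k' hne r c ⟨h₁, h₂⟩
      exact hne (Fin.ext (by have := (hA k r c).1 h₁; have := (hA k' r c).1 h₂; omega))
    · intro r c
      have hrc := Finset.mem_Icc.1 (hM r c)
      obtain ⟨k, hk⟩ : ∃ k : Fin (n ^ 2), M r c = (k : ℕ) + 1 :=
        ⟨⟨M r c - 1, by omega⟩, by simp only; omega⟩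
      refine hk.trans (sum_succ_mul_eq_of_unique _ k ((hA k r c).2 hk) ?_).symm
      intro k' hne h₁
      exact hne (Fin.ext (by have := (hA k' r c).1 h₁; omega))
  · rintro ⟨A, hS, hdisj, hsum⟩
    have hval : ∀ k r c, A k r c = 1 → M r c = (k : ℕ) + 1 := fun k r c hk =>
      (hsum r c).trans (sum_succ_mul_eq_of_unique (fun j => A j r c) k hk
        fun k' hne h₁ => hdisj k' k hne r c ⟨h₁, hk⟩)
    refine (isSudoku_iff_forall_isSPermMatrix n M A fun k r c => ⟨hval k r c, fun hk => ?_⟩).2 hS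
    obtain ⟨j, -, hj⟩ := Finset.exists_ne_zero_of_sum_ne_zero
      (show ∑ j : Fin (n ^ 2), ((j : ℕ) + 1) * (A j r c : ℕ) ≠ 0 by rw [← hsum r c]; omega)
    have hj₁ : A j r c = 1 := by
      have : (A j r c : ℕ) ≠ 0 := right_ne_zero_of_mul hj
      lia
    have : j = k := Fin.ext (by have := hval j r c hj₁; omega)
    exact this ▸ hj₁
end

section
/- For every 4×4 S-permutation matrix A (case n = 2), the number of 4×4 S-permutation matrices B disjoint from A is exactly 7. -/
/-- The binary matrix whose `1` in block `(i, k)` sits at row `k + a i` and column `i + b k`. -/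
def sPermOf (a b : Fin 2 → Fin 2) (r c : Fin 2 × Fin 2) : Fin 2 :=
  if r.2 = c.1 + a r.1 ∧ c.2 = r.1 + b c.1 then 1 else 0

theorem sPermOf_eq_one {a b : Fin 2 → Fin 2} {r c : Fin 2 × Fin 2} :
    sPermOf a b r c = 1 ↔ r.2 = c.1 + a r.1 ∧ c.2 = r.1 + b c.1 := by
  simp [sPermOf]

theorem Fin.two_add_eq_iff : ∀ x y z : Fin 2, x = y + z ↔ y = x + z := by decide

theorem Fin.two_eq_add_of_ne : ∀ f : Fin 2 → Fin 2, f 0 ≠ f 1 → ∀ k, f k = k + f 0 := by decide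

theorem isSPermMatrix_sPermOf (a b : Fin 2 → Fin 2) : IsSPermMatrix 2 (sPermOf a b) := by
  simp only [IsSPermMatrix, sPermOf_eq_one]
  refine ⟨fun ⟨i, j⟩ => ⟨(j + a i, i + b (j + a i)), ?_, ?_⟩,
    fun ⟨k, l⟩ => ⟨(l + b k, k + a (l + b k)), ?_, ?_⟩,
    fun i k => ⟨(k + a i, i + b k), ⟨rfl, rfl⟩, ?_⟩⟩
  · exact ⟨(Fin.two_add_eq_iff _ _ _).2 rfl, rfl⟩
  · rintro ⟨k, l⟩ ⟨h, h'⟩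
    obtain rfl : k = j + a i := (Fin.two_add_eq_iff _ _ _).1 h
    exact Prod.ext rfl h'
  · exact ⟨rfl, (Fin.two_add_eq_iff _ _ _).2 rfl⟩
  · rintro ⟨i, j⟩ ⟨h, h'⟩
    obtain rfl : i = l + b k := (Fin.two_add_eq_iff _ _ _).1 h'
    exact Prod.ext rfl h
  · rintro ⟨j, l⟩ ⟨h, h'⟩
    exact Prod.ext h h'

theorem IsSPermMatrix.exists_eq_sPermOf {A : Fin 2 × Fin 2 → Fin 2 × Fin 2 → Fin 2}
    (hA : IsSPermMatrix 2 A) : ∃ a b, sPermOf a b = A := by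
  obtain ⟨hrow, hcol, hblock⟩ := hA
  choose p hp hp_unique using hblock
  have hne_row (i : Fin 2) : (p i 0).1 ≠ (p i 1).1 := fun h => by
    have h1 := hp i 1
    simp only [← h] at h1
    simpa using congrArg Prod.fst ((hrow _).unique (hp i 0) h1)
  have hne_col (k : Fin 2) : (p 0 k).2 ≠ (p 1 k).2 := fun h => by
    have h1 := hp 1 k
    simp only [← h] at h1
    simpa using congrArg Prod.fst ((hcol _).unique (hp 0 k) h1)
  have hrow_eq (i k : Fin 2) : (p i k).1 = k + (p i 0).1 :=
    Fin.two_eq_add_of_ne (fun k => (p i k).1) (hne_row i) k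
  have hcol_eq (i k : Fin 2) : (p i k).2 = i + (p 0 k).2 :=
    Fin.two_eq_add_of_ne (fun i => (p i k).2) (hne_col k) i
  refine ⟨fun i => (p i 0).1, fun k => (p 0 k).2, ?_⟩
  funext ⟨i, j⟩ ⟨k, l⟩
  have key : sPermOf (fun i => (p i 0).1) (fun k => (p 0 k).2) (i, j) (k, l) = 1 ↔
      A (i, j) (k, l) = 1 := by
    simp only [sPermOf_eq_one, ← hrow_eq, ← hcol_eq]
    constructor
    · rintro ⟨rfl, rfl⟩
      exact hp i k
    · intro h
      exact Prod.ext_iff.1 (hp_unique i k (j, l) h)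
  generalize sPermOf _ _ _ _ = x at key ⊢
  generalize A _ _ = y at key ⊢
  revert x y
  decide

theorem sPermOf_injective :
    Function.Injective fun ab : (Fin 2 → Fin 2) × (Fin 2 → Fin 2) => sPermOf ab.1 ab.2 := by
  rintro ⟨a, b⟩ ⟨a', b'⟩ h
  have key (i k : Fin 2) : k + a i = k + a' i ∧ i + b k = i + b' k := by
    rw [← sPermOf_eq_one (r := (i, k + a i)) (c := (k, i + b k))]
    exact (congrFun₂ h _ _).symm.trans (sPermOf_eq_one.2 ⟨rfl, rfl⟩)
  exact Prod.ext (funext fun i => add_left_cancel (key i 0).1)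
    (funext fun k => add_left_cancel (key 0 k).2)

theorem disjointBin_sPermOf_iff {a b a' b' : Fin 2 → Fin 2} :
    DisjointBin 2 (sPermOf a b) (sPermOf a' b') ↔ ∀ i k, ¬(a i = a' i ∧ b k = b' k) := by
  simp only [DisjointBin, sPermOf_eq_one]
  constructor
  · rintro h i k ⟨ha, hb⟩
    exact h (i, k + a i) (k, i + b k) ⟨⟨rfl, rfl⟩, by rw [ha], by rw [hb]⟩
  · rintro h ⟨i, j⟩ ⟨k, l⟩ ⟨⟨hj, hl⟩, hj', hl'⟩
    exact h i k ⟨add_left_cancel (hj.symm.trans hj'), add_left_cancel (hl.symm.trans hl')⟩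

theorem card_forall_not_agree : ∀ a b : Fin 2 → Fin 2,
    Fintype.card {ab : (Fin 2 → Fin 2) × (Fin 2 → Fin 2) //
      ∀ i k, ¬(a i = ab.1 i ∧ b k = ab.2 k)} = 7 := by
  decide +kernel

/-- For every 4×4 S-permutation matrix `A` (case `n = 2`), the number of 4×4
S-permutation matrices disjoint from `A` is exactly 7. -/
theorem xi_two (A : Fin 2 × Fin 2 → Fin 2 × Fin 2 → Fin 2) (hA : IsSPermMatrix 2 A) :
    Nat.card {B : Fin 2 × Fin 2 → Fin 2 × Fin 2 → Fin 2 //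
        IsSPermMatrix 2 B ∧ DisjointBin 2 A B} = 7 := by
  obtain ⟨a, b, rfl⟩ := hA.exists_eq_sPermOf
  rw [← card_forall_not_agree a b, ← Nat.card_eq_fintype_card]
  refine (Nat.card_congr (Equiv.ofBijective
    (fun ab => ⟨sPermOf ab.1.1 ab.1.2, isSPermMatrix_sPermOf _ _,
      disjointBin_sPermOf_iff.2 ab.2⟩) ⟨fun ab ab' h => ?_, ?_⟩)).symm
  · exact Subtype.ext (sPermOf_injective (congrArg Subtype.val h))
  · rintro ⟨B, hB, hAB⟩
    obtain ⟨a', b', rfl⟩ := hB.exists_eq_sPermOf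
    exact ⟨⟨(a', b'), disjointBin_sPermOf_iff.1 hAB⟩, rfl⟩
end

section
/- The number of unordered pairs {A, B} of distinct disjoint 4×4 S-permutation matrices (case n = 2) is exactly 56. -/
/-- The data of a `4 × 4` S-permutation matrix: the relative row of the one in each block `(i, 0)`
and the relative column of the one in each block `(0, k)`. -/
abbrev SPermCode : Type := (Fin 2 → Fin 2) × (Fin 2 → Fin 2)

/-- The matrix encoded by `q`: the one of block `(i, k)` sits at row `q.1 i + k`, column
`q.2 k + i` of that block. -/
def SPermCode.toMatrix (q : SPermCode) : Fin 2 × Fin 2 → Fin 2 × Fin 2 → Fin 2 :=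
  fun r c => if r.2 = q.1 r.1 + c.1 ∧ c.2 = q.2 c.1 + r.1 then 1 else 0

theorem SPermCode.toMatrix_eq_one_iff (q : SPermCode) (r c : Fin 2 × Fin 2) :
    q.toMatrix r c = 1 ↔ r.2 = q.1 r.1 + c.1 ∧ c.2 = q.2 c.1 + r.1 := by
  simp [SPermCode.toMatrix]

theorem SPermCode.isSPermMatrix_toMatrix (q : SPermCode) : IsSPermMatrix 2 q.toMatrix := by
  refine ⟨fun r => ?_, fun c => ?_, fun i k => ?_⟩
  · refine ⟨(r.2 - q.1 r.1, q.2 (r.2 - q.1 r.1) + r.1), ?_, ?_⟩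
    · simp [toMatrix_eq_one_iff]
    · rintro ⟨k, l⟩ h
      obtain ⟨h₁, h₂⟩ := (toMatrix_eq_one_iff _ _ _).1 h
      simp_all
  · refine ⟨(c.2 - q.2 c.1, q.1 (c.2 - q.2 c.1) + c.1), ?_, ?_⟩
    · simp [toMatrix_eq_one_iff]
    · rintro ⟨i, j⟩ h
      obtain ⟨h₁, h₂⟩ := (toMatrix_eq_one_iff _ _ _).1 h
      simp_all
  · refine ⟨(q.1 i + k, q.2 k + i), ?_, ?_⟩
    · simp [toMatrix_eq_one_iff]
    · rintro ⟨j, l⟩ h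
      obtain ⟨h₁, h₂⟩ := (toMatrix_eq_one_iff _ _ _).1 h
      simp_all

theorem SPermCode.toMatrix_injective : Function.Injective SPermCode.toMatrix := by
  intro q q' h
  have key (i k : Fin 2) : q.1 i = q'.1 i ∧ q.2 k = q'.2 k := by
    have h₁ := (q.toMatrix_eq_one_iff (i, q.1 i + k) (k, q.2 k + i)).2 ⟨rfl, rfl⟩
    rw [h, toMatrix_eq_one_iff] at h₁
    simpa using h₁
  exact Prod.ext (funext fun i => (key i 0).1) (funext fun k => (key 0 k).2)

theorem IsSPermMatrix.exists_toMatrix_eq {A : Fin 2 × Fin 2 → Fin 2 × Fin 2 → Fin 2}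
    (hA : IsSPermMatrix 2 A) : ∃ q : SPermCode, q.toMatrix = A := by
  obtain ⟨hrow, hcol, hblock⟩ := hA
  choose p hp hp_unique using hblock
  have hrow_ne (i : Fin 2) : (p i 0).1 ≠ (p i 1).1 := fun h => by
    have h₀ := hp i 0
    simp only [h] at h₀
    simpa using congrArg Prod.fst ((hrow _).unique h₀ (hp i 1))
  have hcol_ne (k : Fin 2) : (p 0 k).2 ≠ (p 1 k).2 := fun h => by
    have h₀ := hp 0 k
    simp only [h] at h₀
    simpa using congrArg Prod.fst ((hcol _).unique h₀ (hp 1 k))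
  have eq_add_one : ∀ a b : Fin 2, a ≠ b → b = a + 1 := by decide
  have hp_row (i k : Fin 2) : (p i k).1 = (p i 0).1 + k := by
    fin_cases k
    · simp
    · exact eq_add_one _ _ (hrow_ne i)
  have hp_col (i k : Fin 2) : (p i k).2 = (p 0 k).2 + i := by
    fin_cases i
    · simp
    · exact eq_add_one _ _ (hcol_ne k)
  have eq_of_iff : ∀ a b : Fin 2, (a = 1 ↔ b = 1) → a = b := by decide
  refine ⟨(fun i => (p i 0).1, fun k => (p 0 k).2), ?_⟩
  funext ⟨i, j⟩ ⟨k, l⟩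
  apply eq_of_iff
  rw [SPermCode.toMatrix_eq_one_iff]
  simp only [← hp_row, ← hp_col]
  refine ⟨?_, fun h => ?_⟩
  · rintro ⟨rfl, rfl⟩
    exact hp i k
  · have := hp_unique i k (j, l) h
    exact ⟨congrArg Prod.fst this, congrArg Prod.snd this⟩

/-- Codes correspond bijectively to `4 × 4` S-permutation matrices. -/
noncomputable def SPermCode.equiv :
    SPermCode ≃ {A : Fin 2 × Fin 2 → Fin 2 × Fin 2 → Fin 2 // IsSPermMatrix 2 A} :=
  Equiv.ofBijective (fun q => ⟨q.toMatrix, q.isSPermMatrix_toMatrix⟩)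
    ⟨fun _ _ h => toMatrix_injective (congrArg Subtype.val h), fun A =>
      A.2.exists_toMatrix_eq.imp fun _ h => Subtype.ext h⟩

theorem SPermCode.disjointBin_toMatrix_iff (q q' : SPermCode) :
    DisjointBin 2 q.toMatrix q'.toMatrix ↔ ∀ i k, ¬(q.1 i = q'.1 i ∧ q.2 k = q'.2 k) := by
  simp only [DisjointBin, toMatrix_eq_one_iff]
  refine ⟨fun h i k ⟨h₁, h₂⟩ => h (i, q.1 i + k) (k, q.2 k + i) ?_,
    fun h r c ⟨⟨h₁, h₂⟩, h₃, h₄⟩ => h r.1 c.1 ?_⟩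
  · simp [h₁, h₂]
  · exact ⟨add_right_cancel (h₁.symm.trans h₃), add_right_cancel (h₂.symm.trans h₄)⟩

/-- The graph joining two distinct S-permutation matrices when they are disjoint. -/
def sPermDisjointGraph (n : ℕ) :
    SimpleGraph {A : Fin n × Fin n → Fin n × Fin n → Fin 2 // IsSPermMatrix n A} where
  Adj A B := A ≠ B ∧ DisjointBin n A.1 B.1
  symm := ⟨fun _ _ h => ⟨h.1.symm, fun r c hrc => h.2 r c hrc.symm⟩⟩
  loopless := ⟨fun _ h => h.1 rfl⟩

/-- The disjointness graph of `4 × 4` S-permutation matrices, read on codes. -/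
def SPermCode.disjointGraph : SimpleGraph SPermCode where
  Adj q q' := ∀ i k, ¬(q.1 i = q'.1 i ∧ q.2 k = q'.2 k)
  symm := ⟨fun _ _ h i k hik => h i k ⟨hik.1.symm, hik.2.symm⟩⟩
  loopless := ⟨fun _ h => h 0 0 ⟨rfl, rfl⟩⟩

instance : DecidableRel SPermCode.disjointGraph.Adj := fun q q' =>
  inferInstanceAs (Decidable (∀ i k, ¬(q.1 i = q'.1 i ∧ q.2 k = q'.2 k)))

/-- Encoding identifies the two disjointness graphs. -/
noncomputable def SPermCode.disjointGraphIso :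
    SPermCode.disjointGraph ≃g sPermDisjointGraph 2 where
  toEquiv := SPermCode.equiv
  map_rel_iff' {q q'} := by
    refine ⟨fun h => (disjointBin_toMatrix_iff q q').1 h.2, fun h => ⟨?_, ?_⟩⟩
    · exact fun hqq' => SPermCode.disjointGraph.ne_of_adj h (SPermCode.equiv.injective hqq')
    · exact (disjointBin_toMatrix_iff q q').2 h

theorem SPermCode.disjointGraph_degree : SPermCode.disjointGraph.IsRegularOfDegree 7 := by
  unfold SimpleGraph.IsRegularOfDegree
  decide +kernel

theorem SPermCode.card_edgeFinset_disjointGraph :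
    SPermCode.disjointGraph.edgeFinset.card = 56 := by
  have h := SPermCode.disjointGraph.sum_degrees_eq_twice_card_edges
  simp only [SPermCode.disjointGraph_degree.degree_eq] at h
  norm_num at h
  omega

/-- The number of unordered pairs of distinct disjoint 4×4 S-permutation matrices
(case `n = 2`) is exactly 56. -/
theorem eta_two :
    Nat.card {s : Sym2 {A : Fin 2 × Fin 2 → Fin 2 × Fin 2 → Fin 2 // IsSPermMatrix 2 A} //
        ∃ A B, s = s(A, B) ∧ A ≠ B ∧ DisjointBin 2 A.1 B.1} = 56 := by
  have hedge (s) : (∃ A B, s = s(A, B) ∧ A ≠ B ∧ DisjointBin 2 A.1 B.1) ↔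
      s ∈ (sPermDisjointGraph 2).edgeSet := by
    refine ⟨?_, Sym2.ind (fun A B h => ⟨A, B, rfl, h⟩) s⟩
    rintro ⟨A, B, rfl, h⟩
    exact h
  rw [Nat.card_congr (Equiv.subtypeEquivRight hedge),
    ← SPermCode.card_edgeFinset_disjointGraph, SimpleGraph.edgeFinset_card, ← Nat.card_eq_fintype_card]
  exact (Nat.card_congr SPermCode.disjointGraphIso.mapEdgeSet).symm
end

section
/- For every 9×9 S-permutation matrix A (case n = 3), the number of 9×9 S-permutation matrices B disjoint from A is exactly 17972. -/
open Equiv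

/-- The matrix whose unique `1` in block `(i, k)` lies in row `σ i k` and column `τ k i` of it. -/
def sPermMatrix {n : ℕ} (p : (Fin n → Perm (Fin n)) × (Fin n → Perm (Fin n))) :
    Fin n × Fin n → Fin n × Fin n → Fin 2 :=
  fun r c => if r.2 = p.1 r.1 c.1 ∧ c.2 = p.2 c.1 r.1 then 1 else 0

lemma sPermMatrix_eq_one {n : ℕ} (p : (Fin n → Perm (Fin n)) × (Fin n → Perm (Fin n)))
    (r c : Fin n × Fin n) :
    sPermMatrix p r c = 1 ↔ r.2 = p.1 r.1 c.1 ∧ c.2 = p.2 c.1 r.1 := by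
  simp [sPermMatrix]

lemma isSPermMatrix_sPermMatrix {n : ℕ} (p : (Fin n → Perm (Fin n)) × (Fin n → Perm (Fin n))) :
    IsSPermMatrix n (sPermMatrix p) := by
  simp only [IsSPermMatrix, sPermMatrix_eq_one]
  refine ⟨fun ⟨i, j⟩ => ⟨((p.1 i).symm j, p.2 ((p.1 i).symm j) i), by simp, ?_⟩,
    fun ⟨k, l⟩ => ⟨((p.2 k).symm l, p.1 ((p.2 k).symm l) k), by simp, ?_⟩,
    fun i k => ⟨(p.1 i k, p.2 k i), by simp, ?_⟩⟩
  · rintro ⟨k, l⟩ ⟨h1, h2⟩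
    simp_all
  · rintro ⟨i, j⟩ ⟨h1, h2⟩
    simp_all
  · rintro ⟨j, l⟩ ⟨rfl, rfl⟩
    rfl

lemma sPermMatrix_injective {n : ℕ} : Function.Injective (sPermMatrix (n := n)) := by
  intro p q h
  have key (i k : Fin n) : p.1 i k = q.1 i k ∧ p.2 k i = q.2 k i := by
    have := (sPermMatrix_eq_one p (i, p.1 i k) (k, p.2 k i)).2 ⟨rfl, rfl⟩
    rwa [h, sPermMatrix_eq_one] at this
  ext i k : 3
  · exact (key i k).1
  · exact (key k i).2

lemma IsSPermMatrix.exists_eq_sPermMatrix {n : ℕ} {B : Fin n × Fin n → Fin n × Fin n → Fin 2}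
    (hB : IsSPermMatrix n B) : ∃ p, sPermMatrix p = B := by
  obtain ⟨hrow, hcol, hblock⟩ := hB
  choose f hf huniq using hblock
  replace hf (i k : Fin n) : B (i, (f i k).1) (k, (f i k).2) = 1 := hf i k
  have hσ (i : Fin n) : Function.Injective fun k => (f i k).1 := by
    intro k k' h
    have h1 := hf i k
    rw [show (f i k).1 = (f i k').1 from h] at h1
    exact congrArg Prod.fst ((hrow _).unique h1 (hf i k'))
  have hτ (k : Fin n) : Function.Injective fun i => (f i k).2 := by
    intro i i' h
    have h1 := hf i k
    rw [show (f i k).2 = (f i' k).2 from h] at h1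
    exact congrArg Prod.fst ((hcol _).unique h1 (hf i' k))
  refine ⟨(fun i => Equiv.ofBijective _ (Finite.injective_iff_bijective.1 (hσ i)),
    fun k => Equiv.ofBijective _ (Finite.injective_iff_bijective.1 (hτ k))), ?_⟩
  ext ⟨i, j⟩ ⟨k, l⟩ : 2
  have h : sPermMatrix (fun i => Equiv.ofBijective _ (Finite.injective_iff_bijective.1 (hσ i)),
      fun k => Equiv.ofBijective _ (Finite.injective_iff_bijective.1 (hτ k))) (i, j) (k, l) = 1 ↔
      B (i, j) (k, l) = 1 := by
    rw [sPermMatrix_eq_one]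
    constructor
    · rintro ⟨h1, h2⟩
      simp only [Equiv.ofBijective_apply] at h1 h2
      rw [h1, h2]
      exact hf i k
    · intro h
      have := huniq i k (j, l) h
      simp [← this]
  lia

lemma disjointBin_sPermMatrix {n : ℕ} (p q : (Fin n → Perm (Fin n)) × (Fin n → Perm (Fin n))) :
    DisjointBin n (sPermMatrix p) (sPermMatrix q) ↔
      ∀ i k, ¬(q.1 i k = p.1 i k ∧ q.2 k i = p.2 k i) := by
  simp only [DisjointBin, sPermMatrix_eq_one, Prod.forall]
  constructor
  · rintro h i k ⟨h1, h2⟩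
    exact h i (p.1 i k) k (p.2 k i) ⟨⟨rfl, rfl⟩, h1.symm, h2.symm⟩
  · rintro h i j k l ⟨⟨rfl, rfl⟩, h1, h2⟩
    exact h i k ⟨h1.symm, h2.symm⟩

/-- Left translation by the permutations describing `A` reduces the count of the S-permutation
matrices disjoint from `A` to the case where all of these permutations are trivial. -/
lemma card_disjoint_sPermMatrix {n : ℕ} (p : (Fin n → Perm (Fin n)) × (Fin n → Perm (Fin n))) :
    Nat.card {B // IsSPermMatrix n B ∧ DisjointBin n (sPermMatrix p) B} =
      Nat.card {q : (Fin n → Perm (Fin n)) × (Fin n → Perm (Fin n)) //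
        ∀ i k, ¬(q.1 i k = k ∧ q.2 k i = i)} := by
  symm
  have hdisj (q : (Fin n → Perm (Fin n)) × (Fin n → Perm (Fin n))) :
      DisjointBin n (sPermMatrix p) (sPermMatrix (p * q)) ↔
        ∀ i k, ¬(q.1 i k = k ∧ q.2 k i = i) := by
    simp [disjointBin_sPermMatrix]
  refine Nat.card_congr (Equiv.ofBijective
    (fun q => ⟨sPermMatrix (p * q.1), isSPermMatrix_sPermMatrix _, (hdisj _).2 q.2⟩) ⟨?_, ?_⟩)
  · intro q q' h
    exact Subtype.ext (mul_left_cancel (sPermMatrix_injective (congrArg Subtype.val h)))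
  · rintro ⟨B, hB, hAB⟩
    obtain ⟨q, rfl⟩ := hB.exists_eq_sPermMatrix
    refine ⟨⟨p⁻¹ * q, (hdisj _).1 ?_⟩, ?_⟩ <;> simp [hAB]

/-- Once the row permutations `σ` are fixed, the column permutations can be chosen independently. -/
lemma card_not_fixed_eq_sum {n : ℕ} :
    Nat.card {q : (Fin n → Perm (Fin n)) × (Fin n → Perm (Fin n)) //
        ∀ i k, ¬(q.1 i k = k ∧ q.2 k i = i)} =
      ∑ σ : Fin n → Perm (Fin n),
        ∏ k, Fintype.card {τ : Perm (Fin n) // ∀ i, σ i k = k → τ i ≠ i} := by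
  let e : {q : (Fin n → Perm (Fin n)) × (Fin n → Perm (Fin n)) //
        ∀ i k, ¬(q.1 i k = k ∧ q.2 k i = i)} ≃
      Σ σ : Fin n → Perm (Fin n), ∀ k, {τ : Perm (Fin n) // ∀ i, σ i k = k → τ i ≠ i} :=
    { toFun q := ⟨q.1.1, fun k => ⟨q.1.2 k, fun i h1 h2 => q.2 i k ⟨h1, h2⟩⟩⟩
      invFun s := ⟨(s.1, fun k => s.2 k), fun i k h => (s.2 k).2 i h.1 h.2⟩
      left_inv _ := rfl
      right_inv _ := rfl }
  rw [Nat.card_congr e, Nat.card_eq_fintype_card, Fintype.card_sigma]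
  simp only [Fintype.card_pi]

/-- The number of permutations of three points fixing none of `m` given points. -/
def numAvoiding : ℕ → ℕ
  | 0 => 6
  | 1 => 4
  | 2 => 3
  | _ => 2

lemma card_perm_fin_three_avoiding (P : Fin 3 → Bool) :
    Fintype.card {τ : Perm (Fin 3) // ∀ i, P i = true → τ i ≠ i} =
      numAvoiding ((P 0).toNat + (P 1).toNat + (P 2).toNat) := by
  revert P
  decide +kernel

lemma sum_prod_card_perm_fin_three :
    ∑ σ : Fin 3 → Perm (Fin 3),
      ∏ k, Fintype.card {τ : Perm (Fin 3) // ∀ i, σ i k = k → τ i ≠ i} = 17972 := by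
  have h (σ : Fin 3 → Perm (Fin 3)) (k : Fin 3) :
      Fintype.card {τ : Perm (Fin 3) // ∀ i, σ i k = k → τ i ≠ i} =
        numAvoiding ((decide (σ 0 k = k)).toNat + (decide (σ 1 k = k)).toNat +
          (decide (σ 2 k = k)).toNat) := by
    rw [← card_perm_fin_three_avoiding fun i => decide (σ i k = k)]
    simp only [decide_eq_true_eq]
  simp only [h]
  decide +kernel

/-- For every 9×9 S-permutation matrix `A` (case `n = 3`), the number of 9×9
S-permutation matrices disjoint from `A` is exactly 17972. -/
theorem xi_three (A : Fin 3 × Fin 3 → Fin 3 × Fin 3 → Fin 2) (hA : IsSPermMatrix 3 A) :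
    Nat.card {B : Fin 3 × Fin 3 → Fin 3 × Fin 3 → Fin 2 //
        IsSPermMatrix 3 B ∧ DisjointBin 3 A B} = 17972 := by
  obtain ⟨p, rfl⟩ := hA.exists_eq_sPermMatrix
  rw [card_disjoint_sPermMatrix, card_not_fixed_eq_sum, sum_prod_card_perm_fin_three]
end
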